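/- Let t > 0 and let (k(n)) be a sequence of positive integers with (n − k(n))/√n → t as n → ∞, and write r = n − k(n). Then the Stirling number of the second kind satisfies S(n, k(n)) ~ (1/r!) · binomial(n,2)^r · exp(−(4/3)t²) as n → ∞, i.e. the ratio of the two sides tends to 1. -/

import Mathlib

open Finset Filter

/-- `S(n,k)`, the Stirling number of the second kind: the number of partitions of a set of
size `n` into exactly `k` (nonempty) blocks. -/
noncomputable def stirling2 (n k : ℕ) : ℕ :=
  Nat.card {P : Finpartition (Finset.univ : Finset (Fin n)) // P.parts.card = k}

/-- Setoids on `α` with `k` classes correspond to finpartitions with `k` parts. -/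
theorem card_finpartition_eq_card_setoid (α : Type*) [Fintype α] [DecidableEq α] (k : ℕ) :
    Nat.card {P : Finpartition (Finset.univ : Finset α) // P.parts.card = k} =
      Nat.card {s : Setoid α // Nat.card (Quotient s) = k} := by
  classical
  have hpart : ∀ P : Finpartition (Finset.univ : Finset α),
      Nat.card (Quotient (Setoid.ker P.part)) = P.parts.card := by
    intro P
    rw [Nat.card_congr (Setoid.quotientKerEquivRange P.part),
      show Set.range P.part = (P.parts : Set (Finset α)) from ?_]
    · simp
    · ext t
      constructor
      · rintro ⟨a, rfl⟩
        exact P.part_mem.2 (mem_univ a)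
      · intro ht
        obtain ⟨a, ha⟩ := P.nonempty_of_mem_parts ht
        exact ⟨a, P.part_eq_of_mem ht ha⟩
  have hker : ∀ s : Setoid α, Setoid.ker (Finpartition.ofSetoid s).part = s := by
    intro s
    ext a b
    rw [Setoid.ker_def, ← Finpartition.mem_part_ofSetoid_iff_rel (s := s),
      Finpartition.mem_part_iff_part_eq_part _ (mem_univ _) (mem_univ _)]
    exact eq_comm
  refine Nat.card_congr (Equiv.ofBijective
    (fun P => ⟨Setoid.ker P.1.part, (hpart P.1).trans P.2⟩) ⟨?_, ?_⟩)
  · rintro ⟨P, hP⟩ ⟨Q, hQ⟩ h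
    have h1 : Setoid.ker P.part = Setoid.ker Q.part := congrArg Subtype.val h
    have h2 : ∀ a, P.part a = Q.part a := by
      intro a
      ext b
      rw [Finpartition.mem_part_iff_part_eq_part _ (mem_univ _) (mem_univ _),
        Finpartition.mem_part_iff_part_eq_part _ (mem_univ _) (mem_univ _),
        ← Setoid.ker_def, ← Setoid.ker_def, h1]
    have h3 : ∀ P Q : Finpartition (Finset.univ : Finset α), (∀ a, P.part a = Q.part a) →
        P.parts ⊆ Q.parts := by
      intro P Q h t ht
      obtain ⟨a, ha⟩ := P.nonempty_of_mem_parts ht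
      rw [← P.part_eq_of_mem ht ha, h a]
      exact Q.part_mem.2 (mem_univ a)
    exact Subtype.ext (Finpartition.ext ((h3 P Q h2).antisymm (h3 Q P fun a => (h2 a).symm)))
  · rintro ⟨s, hs⟩
    refine ⟨⟨Finpartition.ofSetoid s, ?_⟩, Subtype.ext (hker s)⟩
    rw [← hpart, hker, hs]

/-- The map on `Option α` that extends the quotient map of `s` by the value `o` at `none`. -/
def Setoid.optionMap {α : Type*} (s : Setoid α) (o : Option (Quotient s)) :
    Option α → Option (Quotient s)
  | none => o
  | some a => some (Quotient.mk s a)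

theorem Setoid.bijective_ker_optionMap (α : Type*) :
    Function.Bijective
      (fun x : Σ s : Setoid α, Option (Quotient s) => Setoid.ker (x.1.optionMap x.2)) := by
  classical
  constructor
  · rintro ⟨s, o⟩ ⟨s', o'⟩ h
    have hrel : ∀ u v, s.optionMap o u = s.optionMap o v ↔
        s'.optionMap o' u = s'.optionMap o' v := fun u v => by
      rw [← Setoid.ker_def, ← Setoid.ker_def]
      exact iff_of_eq (congrArg (fun r : Setoid (Option α) => r u v) h)
    have hs : s = s' := by
      ext a b
      simpa only [Setoid.optionMap, Option.some_inj, Quotient.eq] using hrel (some a) (some b)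
    subst hs
    have ho : ∀ q, o = some q ↔ o' = some q := by
      intro q
      induction q using Quotient.inductionOn with
      | h a => simpa [Setoid.optionMap] using hrel none (some a)
    have : o = o' := Option.ext ho
    rw [this]
  · intro r
    by_cases h : ∃ a, r none (some a)
    · obtain ⟨a, ha⟩ := h
      refine ⟨⟨Setoid.comap some r, some (Quotient.mk _ a)⟩, ?_⟩
      ext u v
      rcases u with _ | u <;> rcases v with _ | v <;>
        simp only [Setoid.ker_def, Setoid.optionMap, Option.some_inj, Quotient.eq,
          Setoid.comap_rel, true_iff]
      · exact r.refl' _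
      · exact ⟨fun h => r.trans' ha h, fun h => r.trans' (r.symm' ha) h⟩
      · exact ⟨fun h => r.trans' h (r.symm' ha), fun h => r.trans' h ha⟩
    · refine ⟨⟨Setoid.comap some r, none⟩, ?_⟩
      push Not at h
      ext u v
      rcases u with _ | u <;> rcases v with _ | v <;>
        simp only [Setoid.ker_def, Setoid.optionMap, Option.some_inj, Quotient.eq,
          Setoid.comap_rel, true_iff, reduceCtorEq, false_iff]
      · exact r.refl' _
      · exact h v
      · exact fun h' => h u (r.symm' h')

theorem Setoid.card_quotient_ker_optionMap {α : Type*} [Finite α] (s : Setoid α)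
    (o : Option (Quotient s)) :
    Nat.card (Quotient (Setoid.ker (s.optionMap o))) =
      Nat.card (Quotient s) + if o = none then 1 else 0 := by
  rw [Nat.card_congr (Setoid.quotientKerEquivRange _)]
  rcases o with _ | q
  · rw [show Set.range (s.optionMap none) = Set.univ from ?_]
    · simp [Finite.card_option]
    · rw [Set.range_eq_univ]
      rintro (_ | q)
      · exact ⟨none, rfl⟩
      · induction q using Quotient.inductionOn with
        | h a => exact ⟨some a, rfl⟩
  · rw [show Set.range (s.optionMap (some q)) = Set.range (some : Quotient s → _) from ?_]
    · simpa using Nat.card_congr (Equiv.ofInjective _ (Option.some_injective (Quotient s))).symm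
    · ext t
      constructor
      · rintro ⟨_ | a, rfl⟩
        exacts [⟨q, rfl⟩, ⟨_, rfl⟩]
      · rintro ⟨q, rfl⟩
        induction q using Quotient.inductionOn with
        | h a => exact ⟨some a, rfl⟩

theorem card_setoid_option (α : Type*) [Finite α] (k : ℕ) :
    Nat.card {r : Setoid (Option α) // Nat.card (Quotient r) = k + 1} =
      (k + 1) * Nat.card {s : Setoid α // Nat.card (Quotient s) = k + 1} +
        Nat.card {s : Setoid α // Nat.card (Quotient s) = k} := by
  classical
  have e1 : {x : Σ s : Setoid α, Option (Quotient s) //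
      Nat.card (Quotient x.1) + (if x.2 = none then 1 else 0) = k + 1} ≃
      {r : Setoid (Option α) // Nat.card (Quotient r) = k + 1} :=
    (Equiv.ofBijective _ (Setoid.bijective_ker_optionMap α)).subtypeEquiv fun x => by
      rw [Equiv.ofBijective_apply, Setoid.card_quotient_ker_optionMap]
  have e2 : {x : Σ s : Setoid α, Option (Quotient s) //
      Nat.card (Quotient x.1) + (if x.2 = none then 1 else 0) = k + 1} ≃
      (Σ s : {s : Setoid α // Nat.card (Quotient s) = k + 1}, Quotient s.1) ⊕
        {s : Setoid α // Nat.card (Quotient s) = k} :=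
    { toFun := fun x => match x with
        | ⟨⟨s, none⟩, h⟩ => Sum.inr ⟨s, by simpa using h⟩
        | ⟨⟨s, some q⟩, h⟩ => Sum.inl ⟨⟨s, by simpa using h⟩, q⟩
      invFun := fun y => match y with
        | Sum.inr s => ⟨⟨s.1, none⟩, by simpa using s.2⟩
        | Sum.inl ⟨s, q⟩ => ⟨⟨s.1, some q⟩, by simpa using s.2⟩
      left_inv := by rintro ⟨⟨s, _ | q⟩, h⟩ <;> rfl
      right_inv := by rintro (⟨s, q⟩ | s) <;> rfl }
  have : Finite (Setoid α) := Finite.of_injective (fun s : Setoid α => (s : α → α → Prop))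
    fun s t h => Setoid.ext fun a b => iff_of_eq (congrFun (congrFun h a) b)
  have : Fintype {s : Setoid α // Nat.card (Quotient s) = k + 1} := Fintype.ofFinite _
  rw [← Nat.card_congr e1, Nat.card_congr e2, Nat.card_sum, Nat.card_sigma,
    Finset.sum_congr rfl fun s _ => s.2]
  simp [mul_comm]

theorem Setoid.card_congr_quotient {α β : Type*} (e : α ≃ β) (k : ℕ) :
    Nat.card {s : Setoid α // Nat.card (Quotient s) = k} =
      Nat.card {s : Setoid β // Nat.card (Quotient s) = k} := by
  refine Nat.card_congr (Equiv.subtypeEquiv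
    ⟨Setoid.comap e.symm, Setoid.comap e, fun s => ?_, fun s => ?_⟩ fun s => ?_)
  · ext a b; simp [Setoid.comap_rel]
  · ext a b; simp [Setoid.comap_rel]
  · rw [Nat.card_congr (Quotient.congr e fun a b => ?_)]
    change s a b ↔ s (e.symm (e a)) (e.symm (e b))
    simp

theorem card_setoid_fin (n k : ℕ) :
    Nat.card {s : Setoid (Fin n) // Nat.card (Quotient s) = k} = Nat.stirlingSecond n k := by
  induction n generalizing k with
  | zero =>
    cases k with
    | zero =>
      rw [Nat.stirlingSecond_zero, Nat.card_eq_one_iff_unique]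
      exact ⟨⟨fun a b => Subtype.ext (by ext x; exact x.elim0)⟩, ⟨⊤, by simp⟩⟩
    | succ k =>
      rw [Nat.stirlingSecond_zero_succ, Nat.card_eq_zero]
      exact Or.inl ⟨fun s => by simpa using s.2⟩
  | succ n ih =>
    cases k with
    | zero =>
      rw [Nat.stirlingSecond_succ_zero, Nat.card_eq_zero]
      refine Or.inl ⟨fun s => ?_⟩
      have := s.2
      rw [Finite.card_eq_zero_iff] at this
      exact this.elim (Quotient.mk _ 0)
    | succ k =>
      rw [Setoid.card_congr_quotient (finSuccEquiv n), card_setoid_option, ih, ih,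
        Nat.stirlingSecond_succ_succ]

theorem stirling2_eq_stirlingSecond (n k : ℕ) : stirling2 n k = Nat.stirlingSecond n k := by
  rw [stirling2, card_finpartition_eq_card_setoid, card_setoid_fin]

/-- `S(k + r, k)`, as a real number. -/
noncomputable def stirlingDiag (k r : ℕ) : ℝ := (Nat.stirlingSecond (k + r) k : ℝ)

theorem stirlingDiag_zero_right (k : ℕ) : stirlingDiag k 0 = 1 := by
  simp [stirlingDiag, Nat.stirlingSecond_self]

theorem stirlingDiag_zero_left (r : ℕ) : stirlingDiag 0 (r + 1) = 0 := by
  simp [stirlingDiag]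

theorem stirlingDiag_succ_succ (k r : ℕ) :
    stirlingDiag (k + 1) (r + 1) =
      (k + 1) * stirlingDiag (k + 1) r + stirlingDiag k (r + 1) := by
  rw [stirlingDiag, show k + 1 + (r + 1) = (k + r + 1) + 1 by ring, Nat.stirlingSecond_succ_succ,
    stirlingDiag, stirlingDiag, show k + 1 + r = k + r + 1 by ring, add_assoc k r 1]
  push_cast
  ring

/-- The sum `0 ^ j + 1 ^ j + ⋯ + k ^ j`. -/
noncomputable def powerSum (k j : ℕ) : ℝ := ∑ i ∈ range (k + 1), (i : ℝ) ^ j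

theorem powerSum_zero_succ (j : ℕ) : powerSum 0 (j + 1) = 0 := by
  simp [powerSum]

theorem powerSum_succ (k j : ℕ) : powerSum (k + 1) j = powerSum k j + ((k : ℝ) + 1) ^ j := by
  rw [powerSum, sum_range_succ, powerSum]
  push_cast
  rfl

theorem powerSum_nonneg (k j : ℕ) : 0 ≤ powerSum k j :=
  sum_nonneg fun i _ => by positivity

theorem powerSum_one (k : ℕ) : powerSum k 1 = k * (k + 1) / 2 := by
  induction k with
  | zero => simp [powerSum]
  | succ k ih => rw [powerSum_succ, ih]; push_cast; ring

theorem powerSum_two (k : ℕ) : powerSum k 2 = k * (k + 1) * (2 * k + 1) / 6 := by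
  induction k with
  | zero => simp [powerSum]
  | succ k ih => rw [powerSum_succ, ih]; push_cast; ring

theorem powerSum_le (k j : ℕ) : powerSum k (j + 1) ≤ (k : ℝ) ^ j * powerSum k 1 := by
  rw [powerSum, powerSum, mul_sum]
  refine sum_le_sum fun i hi => ?_
  rw [pow_succ, pow_one]
  have : (i : ℝ) ≤ k := by exact_mod_cast Nat.lt_succ_iff.1 (mem_range.1 hi)
  gcongr

/-- Newton's identity relating complete homogeneous sums to power sums. -/
theorem succ_mul_stirlingDiag_succ (k r : ℕ) :
    ((r : ℝ) + 1) * stirlingDiag k (r + 1) =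
      ∑ x ∈ antidiagonal r, powerSum k (x.1 + 1) * stirlingDiag k x.2 := by
  induction k generalizing r with
  | zero => simp [stirlingDiag_zero_left, powerSum_zero_succ]
  | succ k ihk =>
    have split : ∀ r, ∑ x ∈ antidiagonal r, powerSum (k + 1) (x.1 + 1) * stirlingDiag (k + 1) x.2 =
        ∑ x ∈ antidiagonal r, powerSum k (x.1 + 1) * stirlingDiag (k + 1) x.2 +
          ∑ x ∈ antidiagonal r, ((k : ℝ) + 1) ^ (x.1 + 1) * stirlingDiag (k + 1) x.2 := by
      intro r
      rw [← sum_add_distrib]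
      exact sum_congr rfl fun x _ => by rw [powerSum_succ]; ring
    induction r with
    | zero =>
      have := ihk 0
      simp only [Finset.Nat.antidiagonal_zero, sum_singleton, stirlingDiag_zero_right, zero_add,
        Nat.cast_zero, one_mul, mul_one] at this ⊢
      rw [show (1 : ℕ) = 0 + 1 from rfl, stirlingDiag_succ_succ, stirlingDiag_zero_right, zero_add,
        this, powerSum_succ]
      ring
    | succ r ihr =>
      have h1 : ∑ x ∈ antidiagonal (r + 1), powerSum k (x.1 + 1) * stirlingDiag (k + 1) x.2 =
          ((k : ℝ) + 1) * ∑ x ∈ antidiagonal r, powerSum k (x.1 + 1) * stirlingDiag (k + 1) x.2 +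
            ∑ x ∈ antidiagonal (r + 1), powerSum k (x.1 + 1) * stirlingDiag k x.2 := by
        rw [Finset.Nat.sum_antidiagonal_succ', Finset.Nat.sum_antidiagonal_succ', mul_sum]
        simp only [stirlingDiag_zero_right, stirlingDiag_succ_succ, mul_add, sum_add_distrib]
        rw [sum_congr rfl fun x _ => mul_left_comm (powerSum k (x.1 + 1)) ((k : ℝ) + 1) _]
        ring
      have h2 : ∑ x ∈ antidiagonal (r + 1), ((k : ℝ) + 1) ^ (x.1 + 1) * stirlingDiag (k + 1) x.2 =
          ((k : ℝ) + 1) * stirlingDiag (k + 1) (r + 1) +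
            ((k : ℝ) + 1) *
              ∑ x ∈ antidiagonal r, ((k : ℝ) + 1) ^ (x.1 + 1) * stirlingDiag (k + 1) x.2 := by
        rw [Finset.Nat.sum_antidiagonal_succ, mul_sum]
        simp only [zero_add, pow_one]
        congr 1
        exact sum_congr rfl fun x _ => by ring
      rw [split] at ihr
      rw [split, h1, h2, ← ihk, stirlingDiag_succ_succ]
      push_cast
      linear_combination ((k : ℝ) + 1) * ihr

/-- `S(k + r, k)` divided by its first approximation `(1 + 2 + ⋯ + k) ^ r / r!`. -/
noncomputable def stirlingRatio (k r : ℕ) : ℝ :=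
  (r.factorial : ℝ) * stirlingDiag k r / powerSum k 1 ^ r

theorem stirlingRatio_zero_right (k : ℕ) : stirlingRatio k 0 = 1 := by
  simp [stirlingRatio, stirlingDiag_zero_right]

theorem stirlingRatio_nonneg (k r : ℕ) : 0 ≤ stirlingRatio k r := by
  have := powerSum_nonneg k 1
  unfold stirlingRatio stirlingDiag
  positivity

/-- The coefficients of the recurrence satisfied by `stirlingRatio k`. -/
noncomputable def stirlingCoeff (k r i : ℕ) : ℝ :=
  (r.descFactorial i : ℝ) * (powerSum k (i + 1) / powerSum k 1 ^ (i + 1))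

theorem stirlingCoeff_nonneg (k r i : ℕ) : 0 ≤ stirlingCoeff k r i := by
  have := powerSum_nonneg k 1
  have := powerSum_nonneg k (i + 1)
  unfold stirlingCoeff
  positivity

theorem powerSum_one_pos {k : ℕ} (hk : 0 < k) : 0 < powerSum k 1 := by
  rw [powerSum_one]
  positivity

theorem stirlingRatio_succ {k : ℕ} (hk : 0 < k) (r : ℕ) :
    stirlingRatio k (r + 1) =
      ∑ i ∈ range (r + 1), stirlingCoeff k r i * stirlingRatio k (r - i) := by
  have hp := powerSum_one_pos hk
  have hN := succ_mul_stirlingDiag_succ k r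
  rw [Finset.Nat.sum_antidiagonal_eq_sum_range_succ
    (fun i j => powerSum k (i + 1) * stirlingDiag k j)] at hN
  rw [stirlingRatio, Nat.factorial_succ]
  push_cast
  rw [mul_comm ((r : ℝ) + 1), mul_assoc, hN, mul_sum, sum_div]
  refine sum_congr rfl fun i hi => ?_
  have hir : i ≤ r := Nat.lt_succ_iff.1 (mem_range.1 hi)
  rw [stirlingCoeff, stirlingRatio, ← Nat.factorial_mul_descFactorial hir,
    show r + 1 = (i + 1) + (r - i) by omega, pow_add (powerSum k 1) (i + 1)]
  push_cast
  field_simp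

theorem stirlingCoeff_zero {k : ℕ} (hk : 0 < k) (r : ℕ) : stirlingCoeff k r 0 = 1 := by
  have hp := powerSum_one_pos hk
  simp [stirlingCoeff, hp.ne']

theorem stirlingCoeff_one (k r : ℕ) :
    stirlingCoeff k r 1 = r * (powerSum k 2 / powerSum k 1 ^ 2) := by
  simp [stirlingCoeff]

theorem stirlingCoeff_le {k : ℕ} (hk : 0 < k) (r i : ℕ) {x : ℝ}
    (hx : 2 * (r : ℝ) / (k + 1) ≤ x) : stirlingCoeff k r i ≤ x ^ i := by
  have hp := powerSum_one_pos hk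
  calc stirlingCoeff k r i
      ≤ (r : ℝ) ^ i * ((k : ℝ) ^ i * powerSum k 1 / powerSum k 1 ^ (i + 1)) := by
        unfold stirlingCoeff
        gcongr
        · exact div_nonneg (powerSum_nonneg _ _) (by positivity)
        · exact_mod_cast Nat.descFactorial_le_pow r i
        · exact powerSum_le k i
    _ = (r * k / powerSum k 1) ^ i := by
        rw [div_pow, mul_pow, pow_succ]
        field_simp
    _ = (2 * (r : ℝ) / (k + 1)) ^ i := by
        rw [powerSum_one]
        congr 1
        field_simp
    _ ≤ x ^ i := by gcongr

theorem stirlingRatio_mono {k : ℕ} (hk : 0 < k) : Monotone (stirlingRatio k) := by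
  refine monotone_nat_of_le_succ fun r => ?_
  rw [stirlingRatio_succ hk, sum_range_succ', stirlingCoeff_zero hk, one_mul, Nat.sub_zero]
  exact le_add_of_nonneg_left (sum_nonneg fun i _ =>
    mul_nonneg (stirlingCoeff_nonneg _ _ _) (stirlingRatio_nonneg _ _))

theorem geom_tail_le {x : ℝ} (hx0 : 0 ≤ x) (hx : x ≤ 1 / 2) (m r : ℕ) :
    ∑ i ∈ range r, x ^ (i + m) ≤ 2 * x ^ m := by
  simp only [pow_add]
  rw [← sum_mul]
  gcongr
  calc ∑ i ∈ range r, x ^ i ≤ ∑ i ∈ range r, (1 / 2 : ℝ) ^ i := by gcongr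
    _ ≤ 2 := sum_geometric_two_le r

theorem sum_stirlingCoeff_mul_le {k : ℕ} (hk : 0 < k) (r m N : ℕ) {x : ℝ}
    (hx : 2 * (r : ℝ) / (k + 1) ≤ x) (hx' : x ≤ 1 / 2) :
    ∑ i ∈ range N, stirlingCoeff k r (i + m) * stirlingRatio k (r - (i + m)) ≤
      2 * x ^ m * stirlingRatio k r := by
  have hx0 : 0 ≤ x := le_trans (by positivity) hx
  have hg := stirlingRatio_nonneg k r
  calc _ ≤ ∑ i ∈ range N, x ^ (i + m) * stirlingRatio k r := by
        refine sum_le_sum fun i _ => mul_le_mul (stirlingCoeff_le hk r _ hx)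
          (stirlingRatio_mono hk (Nat.sub_le _ _)) (stirlingRatio_nonneg _ _) (by positivity)
    _ ≤ _ := by
        rw [← sum_mul]
        gcongr
        exact geom_tail_le hx0 hx' m N

theorem stirlingRatio_succ_le {k : ℕ} (hk : 0 < k) (r : ℕ) {x : ℝ}
    (hx : 2 * (r : ℝ) / (k + 1) ≤ x) (hx' : x ≤ 1 / 2) :
    stirlingRatio k (r + 1) ≤ (1 + 2 * x) * stirlingRatio k r := by
  have h := sum_stirlingCoeff_mul_le hk r 1 r hx hx'
  rw [stirlingRatio_succ hk, sum_range_succ', stirlingCoeff_zero hk, Nat.sub_zero]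
  linarith

theorem stirlingRatio_succ_le_sq {k : ℕ} (hk : 0 < k) (r : ℕ) {x : ℝ}
    (hx : 2 * (r : ℝ) / (k + 1) ≤ x) (hx' : x ≤ 1 / 2) :
    stirlingRatio k (r + 1) ≤
      (1 + r * (powerSum k 2 / powerSum k 1 ^ 2) + 2 * x ^ 2) * stirlingRatio k r := by
  have hx0 : 0 ≤ x := le_trans (by positivity) hx
  have hg := stirlingRatio_nonneg k r
  rcases r with _ | r
  · rw [stirlingRatio_succ hk, sum_range_one, stirlingCoeff_zero hk, Nat.sub_zero]
    simp only [Nat.cast_zero, zero_mul, add_zero]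
    gcongr
    nlinarith
  · have h := sum_stirlingCoeff_mul_le hk (r + 1) 2 r hx hx'
    have h1 : stirlingCoeff k (r + 1) 1 * stirlingRatio k (r + 1 - 1) ≤
        stirlingCoeff k (r + 1) 1 * stirlingRatio k (r + 1) :=
      mul_le_mul_of_nonneg_left (stirlingRatio_mono hk (Nat.sub_le _ _))
        (stirlingCoeff_nonneg _ _ _)
    rw [stirlingRatio_succ hk, sum_range_succ', sum_range_succ', stirlingCoeff_zero hk,
      Nat.sub_zero, ← stirlingCoeff_one]
    simp only [zero_add, add_assoc, Nat.reduceAdd] at h h1 ⊢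
    linarith

theorem le_stirlingRatio_succ {k : ℕ} (hk : 0 < k) (r : ℕ) {x : ℝ}
    (hx : 2 * (r : ℝ) / (k + 1) ≤ x) (hx' : x ≤ 1 / 2) :
    (1 + r * (powerSum k 2 / powerSum k 1 ^ 2) / (1 + 2 * x)) * stirlingRatio k r ≤
      stirlingRatio k (r + 1) := by
  have hx0 : 0 ≤ x := le_trans (by positivity) hx
  rcases r with _ | r
  · simpa using stirlingRatio_mono hk (Nat.zero_le 1)
  · have hle : stirlingRatio k (r + 1) / (1 + 2 * x) ≤ stirlingRatio k r := by
      rw [div_le_iff₀ (by positivity), mul_comm]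
      refine stirlingRatio_succ_le hk r (le_trans ?_ hx) hx'
      gcongr
      simp
    have h1 : stirlingCoeff k (r + 1) 1 * (stirlingRatio k (r + 1) / (1 + 2 * x)) ≤
        stirlingCoeff k (r + 1) 1 * stirlingRatio k r :=
      mul_le_mul_of_nonneg_left hle (stirlingCoeff_nonneg _ _ _)
    have h2 : 0 ≤ ∑ i ∈ range r, stirlingCoeff k (r + 1) (i + 1 + 1) *
        stirlingRatio k (r + 1 - (i + 1 + 1)) :=
      sum_nonneg fun i _ => mul_nonneg (stirlingCoeff_nonneg _ _ _) (stirlingRatio_nonneg _ _)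
    rw [stirlingRatio_succ hk (r + 1), sum_range_succ', sum_range_succ', stirlingCoeff_zero hk,
      Nat.sub_zero, ← stirlingCoeff_one, zero_add, Nat.add_sub_cancel]
    calc _ = stirlingCoeff k (r + 1) 1 * (stirlingRatio k (r + 1) / (1 + 2 * x)) +
          1 * stirlingRatio k (r + 1) := by ring
      _ ≤ _ := by linarith

theorem Real.exp_div_one_add_le {y : ℝ} (hy : -1 < y) : Real.exp (y / (1 + y)) ≤ 1 + y := by
  have h : 0 < 1 + y := by linarith
  have := Real.one_sub_inv_le_log_of_pos h
  rw [← Real.le_log_iff_exp_le h]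
  convert this using 1
  field_simp
  ring

theorem stirlingRatio_le_exp {k : ℕ} (hk : 0 < k) (r : ℕ) {x : ℝ}
    (hx : 2 * (r : ℝ) / (k + 1) ≤ x) (hx' : x ≤ 1 / 2) :
    stirlingRatio k r ≤
      Real.exp (r * (r - 1) / 2 * (powerSum k 2 / powerSum k 1 ^ 2) + 2 * x ^ 2 * r) := by
  induction r with
  | zero => simp [stirlingRatio_zero_right]
  | succ r ih =>
    have hx1 : 2 * (r : ℝ) / (k + 1) ≤ x := le_trans (by gcongr; simp) hx
    refine (stirlingRatio_succ_le_sq hk r hx1 hx').trans ?_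
    set q := powerSum k 2 / powerSum k 1 ^ 2
    calc _ ≤ Real.exp (r * q + 2 * x ^ 2) * Real.exp (r * (r - 1) / 2 * q + 2 * x ^ 2 * r) := by
          refine mul_le_mul ?_ (ih hx1) (stirlingRatio_nonneg _ _) (Real.exp_nonneg _)
          linarith [Real.add_one_le_exp (r * q + 2 * x ^ 2)]
      _ = _ := by
          rw [← Real.exp_add]
          congr 1
          push_cast
          ring

theorem exp_le_stirlingRatio {k : ℕ} (hk : 0 < k) (r : ℕ) {x : ℝ}
    (hx : 2 * (r : ℝ) / (k + 1) ≤ x) (hx' : x ≤ 1 / 2) :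
    Real.exp (r * (r - 1) / 2 * (powerSum k 2 / powerSum k 1 ^ 2) / (1 + 2 * x) ^ 2) ≤
      stirlingRatio k r := by
  induction r with
  | zero => simp [stirlingRatio_zero_right]
  | succ r ih =>
    have hx0 : 0 ≤ x := le_trans (by positivity) hx
    have hx1 : 2 * (r : ℝ) / (k + 1) ≤ x := le_trans (by gcongr; simp) hx
    refine le_trans ?_ (le_stirlingRatio_succ hk r hx1 hx')
    have hq : r * (powerSum k 2 / powerSum k 1 ^ 2) ≤ x := by
      rw [← stirlingCoeff_one]
      simpa using stirlingCoeff_le hk r 1 hx1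
    have hq0 : 0 ≤ r * (powerSum k 2 / powerSum k 1 ^ 2) := by
      rw [← stirlingCoeff_one]
      exact stirlingCoeff_nonneg _ _ _
    set q := powerSum k 2 / powerSum k 1 ^ 2
    have hy0 : 0 ≤ r * q / (1 + 2 * x) := by positivity
    have hy : r * q / (1 + 2 * x) ≤ 2 * x := by
      refine (div_le_self hq0 (by linarith)).trans (by linarith)
    have hexp : Real.exp (r * q / (1 + 2 * x) ^ 2) ≤ 1 + r * q / (1 + 2 * x) := by
      refine le_trans (Real.exp_le_exp.2 ?_) (Real.exp_div_one_add_le (by linarith))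
      rw [pow_two, ← div_div]
      gcongr
    calc _ = Real.exp (r * q / (1 + 2 * x) ^ 2) *
          Real.exp (r * (r - 1) / 2 * q / (1 + 2 * x) ^ 2) := by
          rw [← Real.exp_add]
          congr 1
          push_cast
          ring
      _ ≤ _ := mul_le_mul hexp (ih hx1) (Real.exp_nonneg _) (by positivity)

theorem tendsto_one_add_pow_exp {ι : Type*} {l : Filter ι} {u : ι → ℝ} {r : ι → ℕ} {c : ℝ}
    (hu : Tendsto u l (nhds 0)) (hru : Tendsto (fun i => r i * u i) l (nhds c)) :
    Tendsto (fun i => (1 + u i) ^ r i) l (nhds (Real.exp c)) := by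
  have hlow : Tendsto (fun i => r i * u i / (1 + u i)) l (nhds c) := by
    simpa [Pi.div_def] using hru.div (hu.const_add 1) (by norm_num)
  have hev : ∀ᶠ i in l, -1 < u i := hu.eventually (lt_mem_nhds (by norm_num))
  refine tendsto_of_tendsto_of_tendsto_of_le_of_le'
    (Real.continuous_exp.continuousAt.tendsto.comp hlow)
    (Real.continuous_exp.continuousAt.tendsto.comp hru) ?_ ?_
  · filter_upwards [hev] with i hi
    calc Real.exp (r i * u i / (1 + u i)) = Real.exp (u i / (1 + u i)) ^ r i := by
          rw [← Real.exp_nat_mul, mul_div_assoc]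
      _ ≤ _ := by
          gcongr
          exact Real.exp_div_one_add_le hi
  · filter_upwards [hev] with i hi
    calc (1 + u i) ^ r i ≤ Real.exp (u i) ^ r i := by
          gcongr
          · linarith
          · linarith [Real.add_one_le_exp (u i)]
      _ = _ := by rw [← Real.exp_nat_mul]; rfl

theorem tendsto_stirlingRatio {t : ℝ} {k r : ℕ → ℕ} (hk : ∀ n, 0 < k n)
    (hn : ∀ᶠ n in atTop, n = k n + r n)
    (hlim : Tendsto (fun n : ℕ => (r n : ℝ) / Real.sqrt n) atTop (nhds t)) :
    Tendsto (fun n => stirlingRatio (k n) (r n)) atTop (nhds (Real.exp (2 / 3 * t ^ 2))) ∧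
    Tendsto (fun n => (powerSum (k n) 1 / (n.choose 2 : ℝ)) ^ r n) atTop
      (nhds (Real.exp (-2 * t ^ 2))) := by
  have hinv : Tendsto (fun n : ℕ => 1 / (n : ℝ)) atTop (nhds 0) := tendsto_one_div_atTop_nhds_zero_nat
  have hsq : Tendsto (fun n : ℕ => 1 / Real.sqrt n) atTop (nhds 0) := by
    have := (Real.continuous_sqrt.tendsto 0).comp hinv
    simpa [Function.comp_def, Real.sqrt_inv] using this
  have hrn : Tendsto (fun n : ℕ => (r n : ℝ) / n) atTop (nhds 0) := by
    have := hlim.mul hsq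
    rw [mul_zero] at this
    refine this.congr fun n => ?_
    rw [div_mul_div_comm, mul_one, Real.mul_self_sqrt (Nat.cast_nonneg n)]
  have hr2 : Tendsto (fun n : ℕ => (r n : ℝ) ^ 2 / n) atTop (nhds (t ^ 2)) := by
    refine (hlim.pow 2).congr fun n => ?_
    rw [div_pow, Real.sq_sqrt (Nat.cast_nonneg n)]
  have hkn : Tendsto (fun n : ℕ => (k n : ℝ) / n) atTop (nhds 1) := by
    have : Tendsto (fun n : ℕ => 1 - (r n : ℝ) / n) atTop (nhds 1) := by
      simpa using hrn.const_sub 1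
    refine this.congr' ?_
    filter_upwards [hn, eventually_gt_atTop 0] with n h h0
    have h' : (n : ℝ) = k n + r n := by exact_mod_cast h
    have h0' : (0 : ℝ) < n := by exact_mod_cast h0
    field_simp
    linarith
  have hk1 : Tendsto (fun n : ℕ => (k n : ℝ) / n + 1 / n) atTop (nhds 1) := by
    simpa using hkn.add hinv
  have hx : Tendsto (fun n : ℕ => 2 * (r n : ℝ) / (k n + 1)) atTop (nhds 0) := by
    have := (hrn.const_mul 2).div hk1 one_ne_zero
    rw [mul_zero, zero_div] at this
    refine this.congr' ?_
    filter_upwards [eventually_gt_atTop 0] with n h0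
    have h0' : (0 : ℝ) < n := by exact_mod_cast h0
    simp only [Pi.div_apply]
    field_simp
  have hx2 : Tendsto (fun n : ℕ => 2 * (2 * (r n : ℝ) / (k n + 1)) ^ 2 * r n) atTop (nhds 0) := by
    have := (((hr2.mul hrn).const_mul 8).div (hk1.pow 2) (by norm_num))
    rw [mul_zero, mul_zero, zero_div] at this
    refine this.congr' ?_
    filter_upwards [eventually_gt_atTop 0] with n h0
    have h0' : (0 : ℝ) < n := by exact_mod_cast h0
    simp only [Pi.div_apply]
    field_simp
    ring
  have hmain : Tendsto (fun n : ℕ => r n * ((r n : ℝ) - 1) / 2 *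
      (powerSum (k n) 2 / powerSum (k n) 1 ^ 2)) atTop (nhds (2 / 3 * t ^ 2)) := by
    have := (((hr2.sub hrn).mul (hkn.add hk1)).const_mul (1 / 3)).div (hkn.mul hk1) (by norm_num)
    rw [show 1 / 3 * ((t ^ 2 - 0) * (1 + 1)) / (1 * 1) = 2 / 3 * t ^ 2 by ring] at this
    refine this.congr' ?_
    filter_upwards [eventually_gt_atTop 0] with n h0
    have h0' : (0 : ℝ) < n := by exact_mod_cast h0
    have hk' : (0 : ℝ) < k n := by exact_mod_cast hk n
    rw [powerSum_one, powerSum_two]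
    simp only [Pi.div_apply]
    field_simp
    ring
  have hxs : ∀ᶠ n in atTop, 2 * (r n : ℝ) / (k n + 1) ≤ 1 / 2 :=
    hx.eventually (ge_mem_nhds (by norm_num))
  constructor
  · have hup := hmain.add hx2
    rw [add_zero] at hup
    have hlow := hmain.div (((hx.const_mul 2).const_add 1).pow 2) (by norm_num)
    rw [show (1 + 2 * (0 : ℝ)) ^ 2 = 1 by norm_num, div_one] at hlow
    refine tendsto_of_tendsto_of_tendsto_of_le_of_le'
      (Real.continuous_exp.continuousAt.tendsto.comp hlow)
      (Real.continuous_exp.continuousAt.tendsto.comp hup) ?_ ?_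
    · filter_upwards [hxs] with n h
      exact exp_le_stirlingRatio (hk n) (r n) le_rfl h
    · filter_upwards [hxs] with n h
      exact stirlingRatio_le_exp (hk n) (r n) le_rfl h
  · have hn1 : Tendsto (fun n : ℕ => 1 - 1 / (n : ℝ)) atTop (nhds 1) := by
      simpa using hinv.const_sub 1
    have hu : Tendsto (fun n : ℕ => powerSum (k n) 1 / (n.choose 2 : ℝ) - 1) atTop (nhds 0) := by
      have := ((hkn.mul hk1).div hn1 one_ne_zero).sub_const 1
      rw [show (1 : ℝ) * 1 / 1 - 1 = 0 by norm_num] at this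
      refine this.congr' ?_
      filter_upwards [eventually_gt_atTop 1] with n h0
      have h0' : (1 : ℝ) < n := by exact_mod_cast h0
      have h1' : (n : ℝ) - 1 ≠ 0 := by linarith
      rw [powerSum_one, Nat.cast_choose_two]
      simp only [Pi.div_apply]
      field_simp
    have hru : Tendsto (fun n : ℕ => r n * (powerSum (k n) 1 / (n.choose 2 : ℝ) - 1)) atTop
        (nhds (-2 * t ^ 2)) := by
      have := ((((hr2.const_mul (-2)).add (hrn.const_mul 2)).add (hr2.mul hrn)).sub
        (hr2.mul hinv)).div hn1 one_ne_zero
      rw [show (-2 * t ^ 2 + 2 * 0 + t ^ 2 * 0 - t ^ 2 * 0) / 1 = -2 * t ^ 2 by ring] at this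
      refine this.congr' ?_
      filter_upwards [hn, eventually_gt_atTop 1] with n h h0
      have h0' : (1 : ℝ) < n := by exact_mod_cast h0
      have h1' : (n : ℝ) - 1 ≠ 0 := by linarith
      have h' : (k n : ℝ) = n - r n := by
        rw [eq_sub_iff_add_eq]
        exact_mod_cast h.symm
      rw [powerSum_one, Nat.cast_choose_two, h']
      simp only [Pi.div_apply]
      field_simp
      ring
    simpa using tendsto_one_add_pow_exp hu hru

/-- if `k(n)` is a sequence of positive integers with `(n − k(n))/√n → t > 0`,
and `r = n − k(n)`, then `S(n, k(n)) ~ (1/r!)·C(n,2)^r·exp(−(4/3)t²)`, i.e. the ratio of the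
two sides tends to `1` as `n → ∞`. -/
theorem stirling_second_kind_asymptotics (t : ℝ) (ht : 0 < t) (k : ℕ → ℕ)
    (hpos : ∀ n, 0 < k n)
    (hlim : Tendsto (fun n : ℕ => ((n - k n : ℕ) : ℝ) / Real.sqrt n) atTop (nhds t)) :
    Tendsto (fun n : ℕ => (stirling2 n (k n) : ℝ) /
        (1 / ((n - k n).factorial : ℝ) * (n.choose 2 : ℝ) ^ (n - k n) *
          Real.exp (-(4/3) * t ^ 2)))
      atTop (nhds 1) := by
  have hn : ∀ᶠ n in atTop, n = k n + (n - k n) := by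
    filter_upwards [hlim.eventually (lt_mem_nhds ht)] with n h
    by_contra hne
    have h0 : n - k n = 0 := by omega
    simp [h0] at h
  obtain ⟨h1, h2⟩ := tendsto_stirlingRatio hpos hn hlim
  have := (h1.mul h2).div_const (Real.exp (-(4 / 3) * t ^ 2))
  rw [← Real.exp_add, ← Real.exp_sub,
    show 2 / 3 * t ^ 2 + -2 * t ^ 2 - -(4 / 3) * t ^ 2 = 0 by ring, Real.exp_zero] at this
  refine this.congr' ?_
  filter_upwards [hn, eventually_gt_atTop 1] with n h h0
  have hp := powerSum_one_pos (hpos n)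
  have hc : (0 : ℝ) < n.choose 2 := by exact_mod_cast Nat.choose_pos h0
  rw [stirling2_eq_stirlingSecond, stirlingRatio, stirlingDiag, ← h, div_pow]
  field_simp
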